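/- arXiv:1204.1805 — 9 statements merged into one kernel-verified Lean document; each statement's English description precedes it below -/
import Mathlib

section
/- Let A and H be groups and let ▷ : H × A → A and ◁ : H × A → H be two maps. Equip the set A × H with the multiplication (a, h)·(b, g) = (a(h ▷ b), (h ◁ b)g). Then A × H with this multiplication is a group with unit (1, 1) if and only if (A, H, ▷, ◁) is a matched pair of groups. -/
/-- The data of a multiplication `mul` and a distinguished element `one` on a set `X`
turns `X` into a group with unit `one`. -/
def IsGroupWithUnit {X : Type*} (mul : X → X → X) (one : X) : Prop :=
  (∀ x y z, mul (mul x y) z = mul x (mul y z)) ∧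
  (∀ x, mul one x = x) ∧ (∀ x, mul x one = x) ∧
  (∀ x, ∃ y, mul y x = one ∧ mul x y = one)

/-- `(A, H, ▷, ◁)` is a matched pair of groups: `▷ = tr` is a left action of the group `H`
on the set `A`, `◁ = tl` is a right action of the group `A` on the set `H`, and the two
compatibility conditions hold. -/
def IsMatchedPair {A H : Type*} [Group A] [Group H]
    (tr : H → A → A) (tl : H → A → H) : Prop :=
  (∀ a, tr 1 a = a) ∧ (∀ h g a, tr (h * g) a = tr h (tr g a)) ∧
  (∀ h, tl h 1 = h) ∧ (∀ h a b, tl h (a * b) = tl (tl h a) b) ∧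
  (∀ h a b, tr h (a * b) = tr h a * tr (tl h a) b) ∧
  (∀ h g a, tl (h * g) a = tl h (tr g a) * tl g a)

/-- The set `A × H` endowed with the multiplication
`(a, h) · (b, g) = (a (h ▷ b), (h ◁ b) g)` is a group with unit `(1, 1)` if and only if
`(A, H, ▷, ◁)` is a matched pair of groups. -/
theorem stmt0 {A H : Type*} [Group A] [Group H]
    (tr : H → A → A) (tl : H → A → H) :
    IsGroupWithUnit
      (fun p q : A × H => (p.1 * tr p.2 q.1, tl p.2 q.1 * q.2)) ((1, 1) : A × H) ↔
    IsMatchedPair tr tl := by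
  constructor
  · rintro ⟨assoc, one_left, one_right, -⟩
    simp only [Prod.forall, Prod.mk.injEq] at assoc one_left one_right
    have tr_one_left : ∀ a, tr 1 a = a := fun a => by simpa using (one_left a 1).1
    have tl_one_left : ∀ a, tl 1 a = 1 := fun a => by simpa using (one_left a 1).2
    have tr_one_right : ∀ h, tr h 1 = 1 := fun h => by simpa using (one_right 1 h).1
    have tl_one_right : ∀ h, tl h 1 = h := fun h => by simpa using (one_right 1 h).2
    refine ⟨tr_one_left, fun h g a => ?_, tl_one_right, fun h a b => ?_,
      fun h a b => ?_, fun h g a => ?_⟩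
    · simpa [tr_one_right, tl_one_right] using (assoc 1 h 1 g a 1).1
    · simpa [tr_one_left, tl_one_left] using (assoc 1 h a 1 b 1).2.symm
    · simpa [tr_one_left] using (assoc 1 h a 1 b 1).1.symm
    · simpa [tl_one_right] using (assoc 1 h 1 g a 1).2
  · rintro ⟨tr_one_left, tr_mul_left, tl_one_right, tl_mul_right, tr_mul_right, tl_mul_left⟩
    have tr_one_right : ∀ h, tr h 1 = 1 := fun h => by
      simpa [tl_one_right] using tr_mul_right h 1 1
    have tl_one_left : ∀ a, tl 1 a = 1 := fun a => by
      simpa [tr_one_left] using tl_mul_left 1 1 a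
    refine ⟨?_, ?_, ?_, ?_⟩
    · rintro ⟨a, h⟩ ⟨b, g⟩ ⟨c, k⟩
      simp only [tr_mul_right, tl_mul_left, tr_mul_left, tl_mul_right, mul_assoc]
    · rintro ⟨a, h⟩
      simp [tr_one_left, tl_one_left]
    · rintro ⟨a, h⟩
      simp [tr_one_right, tl_one_right]
    · rintro ⟨a, h⟩
      refine ⟨(tr h⁻¹ a⁻¹, tl h⁻¹ a⁻¹), ?_, ?_⟩
      · simp [← tr_mul_right, ← tl_mul_right, tr_one_right, tl_one_right]
      · simp [← tr_mul_left, ← tl_mul_left, tr_one_left, tl_one_left]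
end

section
/- Let (A, H, ▷, ◁) and (A, H', ▷', ◁') be two matched pairs of groups. There is a bijection between the set of all group morphisms ψ : A ⋈' H' → A ⋈ H that stabilize A and the set of all pairs (r, v), where r : H' → A and v : H' → H are maps with r(1) = 1 and v(1) = 1 satisfying, for all h', g' ∈ H' and a ∈ A: (i) h' ▷' a = r(h')(v(h') ▷ a) r(h' ◁' a)^{-1}; (ii) v(h' ◁' a) = v(h') ◁ a; (iii) r(h'g') = r(h')(v(h') ▷ r(g')); (iv) v(h'g') = (v(h') ◁ r(g')) v(g'). Under this correspondence ψ(a, h') = (a r(h'), v(h')), and ψ is an isomorphism of groups if and only if v : H' → H is bijective. -/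
/-- A matched pair of groups `(A, H, ▷, ◁)`. -/
structure MatchedPair (A H : Type*) [Group A] [Group H] where
  tr : H → A → A
  tl : H → A → H
  tr_one_act : ∀ a, tr 1 a = a
  tr_mul_act : ∀ h g a, tr (h * g) a = tr h (tr g a)
  tl_one_act : ∀ h, tl h 1 = h
  tl_mul_act : ∀ h a b, tl h (a * b) = tl (tl h a) b
  compat_tr : ∀ h a b, tr h (a * b) = tr h a * tr (tl h a) b
  compat_tl : ∀ h g a, tl (h * g) a = tl h (tr g a) * tl g a

/-- The multiplication of the bicrossed product `A ⋈ H`. -/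
def MatchedPair.bmul {A H : Type*} [Group A] [Group H] (mp : MatchedPair A H)
    (p q : A × H) : A × H :=
  (p.1 * mp.tr p.2 q.1, mp.tl p.2 q.1 * q.2)

namespace MatchedPair

variable {A H H' : Type*} [Group A] [Group H] [Group H']

theorem tr_one (mp : MatchedPair A H) (h : H) : mp.tr h 1 = 1 := by
  have e := mp.compat_tr h 1 1
  rw [mp.tl_one_act, mul_one] at e
  exact right_eq_mul.mp e

theorem tl_one (mp : MatchedPair A H) (a : A) : mp.tl 1 a = 1 := by
  have e := mp.compat_tl 1 1 a
  rw [mp.tr_one_act, mul_one] at e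
  exact right_eq_mul.mp e

/-- A multiplicative map stabilizing `A` is determined by its values on the second factor. -/
theorem apply_eq_of_stabilizes {mp : MatchedPair A H} {mp' : MatchedPair A H'}
    {ψ : A × H' → A × H} (hψ : ∀ p q, ψ (mp'.bmul p q) = mp.bmul (ψ p) (ψ q))
    (hA : ∀ a : A, ψ (a, 1) = (a, 1)) (a : A) (h : H') :
    ψ (a, h) = (a * (ψ (1, h)).1, (ψ (1, h)).2) := by
  have e := hψ (a, 1) (1, h)
  rw [hA] at e
  simpa [bmul, mp.tr_one_act, mp'.tr_one_act, tl_one] using e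

/-- The map `(a, h) ↦ (a r(h), v(h))` is multiplicative and stabilizes `A` exactly when
`(r, v)` is a unit preserving pair satisfying the compatibility conditions. -/
theorem stabilizing_hom_iff (mp : MatchedPair A H) (mp' : MatchedPair A H')
    (r : H' → A) (v : H' → H) :
    ((∀ p q, (fun p : A × H' => (p.1 * r p.2, v p.2)) (mp'.bmul p q) =
        mp.bmul (p.1 * r p.2, v p.2) (q.1 * r q.2, v q.2)) ∧
      (∀ a : A, (a * r 1, v 1) = (a, (1 : H)))) ↔
    r 1 = 1 ∧ v 1 = 1 ∧
      (∀ h' a, mp'.tr h' a = r h' * mp.tr (v h') a * (r (mp'.tl h' a))⁻¹) ∧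
      (∀ h' a, v (mp'.tl h' a) = mp.tl (v h') a) ∧
      (∀ h' g', r (h' * g') = r h' * mp.tr (v h') (r g')) ∧
      (∀ h' g', v (h' * g') = mp.tl (v h') (r g') * v g') := by
  constructor
  · rintro ⟨hm, hA⟩
    obtain ⟨hr, hv⟩ : r 1 = 1 ∧ v 1 = 1 := by simpa using hA 1
    have hAH (h : H') (a : A) := hm (1, h) (a, 1)
    have hHH (h g : H') := hm (1, h) (1, g)
    simp only [bmul, hr, hv, one_mul, mul_one, Prod.mk.injEq] at hAH
    simp only [bmul, tr_one, mp'.tl_one_act, one_mul, Prod.mk.injEq] at hHH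
    exact ⟨hr, hv, fun h a => eq_mul_inv_of_mul_eq (hAH h a).1, fun h a => (hAH h a).2,
      fun h g => (hHH h g).1, fun h g => (hHH h g).2⟩
  · rintro ⟨hr, hv, htr, htl, hrm, hvm⟩
    refine ⟨fun p q => ?_, fun a => by rw [hr, hv, mul_one]⟩
    simp only [bmul, Prod.mk.injEq]
    constructor
    · rw [hrm, htl, htr, mp.compat_tr]
      group
    · rw [hvm, htl, mp.tl_mul_act]

end MatchedPair

theorem Function.bijective_mul_prodMk_iff {A H H' : Type*} [Group A] [Nonempty H'] (r : H' → A)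
    (v : H' → H) :
    Function.Bijective (fun p : A × H' => (p.1 * r p.2, v p.2)) ↔ Function.Bijective v := by
  have e : (fun p : A × H' => (p.1 * r p.2, v p.2)) =
      Prod.map id v ∘ fun p : A × H' => (p.1 * r p.2, p.2) := rfl
  have shear : Function.Bijective (fun p : A × H' => (p.1 * r p.2, p.2)) :=
    Function.bijective_iff_has_inverse.mpr
      ⟨fun p => (p.1 * (r p.2)⁻¹, p.2), fun p => by simp, fun p => by simp⟩
  rw [e, Function.Bijective.of_comp_iff _ shear, Prod.map_bijective]
  exact and_iff_right Function.bijective_id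

/-- Takeuchi-type description of morphisms between bicrossed products: for matched pairs
`(A, H, ▷, ◁)` and `(A, H', ▷', ◁')` there is a bijection between the group morphisms
`ψ : A ⋈' H' → A ⋈ H` stabilizing `A` and the pairs of unit preserving maps
`(r, v)`, `r : H' → A`, `v : H' → H` satisfying the four compatibility conditions; the
morphism corresponding to `(r, v)` is `ψ(a, h') = (a r(h'), v(h'))`, and `ψ` is an
isomorphism if and only if `v` is bijective. -/
theorem stmt3 {A H H' : Type*} [Group A] [Group H] [Group H']
    (mp : MatchedPair A H) (mp' : MatchedPair A H') :
    ∃ Φ : {ψ : A × H' → A × H //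
            (∀ p q, ψ (mp'.bmul p q) = mp.bmul (ψ p) (ψ q)) ∧
            (∀ a : A, ψ (a, 1) = (a, 1))} ≃
          {rv : (H' → A) × (H' → H) //
            rv.1 1 = 1 ∧ rv.2 1 = 1 ∧
            (∀ h' a, mp'.tr h' a =
              rv.1 h' * mp.tr (rv.2 h') a * (rv.1 (mp'.tl h' a))⁻¹) ∧
            (∀ h' a, rv.2 (mp'.tl h' a) = mp.tl (rv.2 h') a) ∧
            (∀ h' g', rv.1 (h' * g') = rv.1 h' * mp.tr (rv.2 h') (rv.1 g')) ∧
            (∀ h' g', rv.2 (h' * g') = mp.tl (rv.2 h') (rv.1 g') * rv.2 g')},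
      (∀ ψ, (ψ : {ψ : A × H' → A × H //
            (∀ p q, ψ (mp'.bmul p q) = mp.bmul (ψ p) (ψ q)) ∧
            (∀ a : A, ψ (a, 1) = (a, 1))}).val =
          fun p : A × H' => (p.1 * (Φ ψ).val.1 p.2, (Φ ψ).val.2 p.2)) ∧
      (∀ ψ, Function.Bijective (ψ : {ψ : A × H' → A × H //
            (∀ p q, ψ (mp'.bmul p q) = mp.bmul (ψ p) (ψ q)) ∧
            (∀ a : A, ψ (a, 1) = (a, 1))}).val ↔
          Function.Bijective (Φ ψ).val.2) := by
  let rv (ψ : A × H' → A × H) : (H' → A) × (H' → H) :=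
    (fun h => (ψ (1, h)).1, fun h => (ψ (1, h)).2)
  let toMap (p : (H' → A) × (H' → H)) : A × H' → A × H := fun q => (q.1 * p.1 q.2, p.2 q.2)
  have toMap_rv (ψ : A × H' → A × H)
      (hψ : (∀ p q, ψ (mp'.bmul p q) = mp.bmul (ψ p) (ψ q)) ∧
        (∀ a : A, ψ (a, 1) = (a, 1))) : toMap (rv ψ) = ψ :=
    funext fun p => (MatchedPair.apply_eq_of_stabilizes hψ.1 hψ.2 p.1 p.2).symm
  refine ⟨⟨fun ψ => ⟨rv ψ.1, ?_⟩, fun p => ⟨toMap p.1, ?_⟩, ?_, ?_⟩, ?_, ?_⟩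
  · have h := ψ.2
    rw [← toMap_rv ψ.1 ψ.2] at h
    exact (MatchedPair.stabilizing_hom_iff mp mp' _ _).mp h
  · exact (MatchedPair.stabilizing_hom_iff mp mp' _ _).mpr p.2
  · exact fun ψ => Subtype.ext (toMap_rv ψ.1 ψ.2)
  · exact fun p => Subtype.ext (by simp [rv, toMap])
  · exact fun ψ => (toMap_rv ψ.1 ψ.2).symm
  · intro ψ
    rw [← toMap_rv ψ.1 ψ.2]
    simpa [rv, toMap] using Function.bijective_mul_prodMk_iff (rv ψ.1).1 (rv ψ.1).2
end

section
/- Let k be a positive integer and view the alternating group A_{4k-1} as the subgroup of A_{4k} fixing the point 4k. Let σ' = (1, 2, …, 2k)(2k+1, 2k+2, …, 4k) and τ' = (1, 2k+1)(2, 2k+2) ⋯ (2k, 4k), both elements of A_{4k}. Then σ'τ' = τ'σ', the subgroup ⟨σ', τ'⟩ of A_{4k} is isomorphic to C_2 × C_{2k}, and A_{4k} factorizes through A_{4k-1} and ⟨σ', τ'⟩. Consequently, for k ≥ 2 (where the dihedral group of order 4k is not isomorphic to C_2 × C_{2k}), the factorization index satisfies [A_{4k} : A_{4k-1}]^f ≥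 2. -/
open Equiv

/-- The left regular representation of `G`, transported along a bijection `e : G ≃ X`. -/
def regularRep {G X : Type*} [Group G] (e : G ≃ X) : G →* Perm X :=
  e.permCongrHom.toMonoidHom.comp (MulAction.toPermHom G G)

section RegularRep

variable {G X : Type*} [Group G] (e : G ≃ X)

lemma regularRep_apply (g y : G) : regularRep e g (e y) = e (g * y) := by
  simp [regularRep, Equiv.permCongrHom]

lemma eq_regularRep {f : Perm X} {g : G} (h : ∀ y, f (e y) = e (g * y)) :
    f = regularRep e g := by
  ext x
  obtain ⟨y, rfl⟩ := e.surjective x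
  rw [h, regularRep_apply]

lemma regularRep_injective : Function.Injective (regularRep e) := by
  intro g h hgh
  have := congrArg (fun f => f (e 1)) hgh
  simpa [regularRep_apply] using this

lemma sign_regularRep [Fintype G] [DecidableEq G] [Fintype X] [DecidableEq X] (g : G) :
    Perm.sign (regularRep e g) = Perm.sign (Equiv.mulLeft g) := by
  rw [← Perm.sign_permCongr e]
  congr 1

lemma exists_mem_range_regularRep_apply_eq (p x : X) :
    ∃ h ∈ (regularRep e).range, h p = x := by
  obtain ⟨a, rfl⟩ := e.surjective p
  obtain ⟨b, rfl⟩ := e.surjective x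
  exact ⟨_, ⟨b * a⁻¹, rfl⟩, by rw [regularRep_apply, inv_mul_cancel_right]⟩

lemma eq_one_of_mem_range_regularRep {p : X} {h : Perm X} (hh : h ∈ (regularRep e).range)
    (hp : h p = p) : h = 1 := by
  obtain ⟨g, rfl⟩ := hh
  obtain ⟨a, rfl⟩ := e.surjective p
  rw [regularRep_apply] at hp
  have : g = 1 := by simpa using hp
  simp [this]

/-- A regular subgroup inside `K` is a complement in `K` of every point stabilizer of `K`. -/
lemma range_regularRep_complement (K : Subgroup (Perm X)) (hK : (regularRep e).range ≤ K)
    (p : X) :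
    (∀ g ∈ K, ∃ a ∈ K ⊓ MulAction.stabilizer (Perm X) p,
      ∃ h ∈ (regularRep e).range, g = a * h) ∧
    (K ⊓ MulAction.stabilizer (Perm X) p) ⊓ (regularRep e).range = ⊥ := by
  refine ⟨fun g hg => ?_, ?_⟩
  · obtain ⟨h, hh, hp⟩ := exists_mem_range_regularRep_apply_eq e p (g⁻¹ p)
    refine ⟨g * h, ⟨K.mul_mem hg (hK hh), ?_⟩, h⁻¹, inv_mem hh, by simp⟩
    simp [MulAction.mem_stabilizer_iff, hp]
  · rw [eq_bot_iff]
    rintro h ⟨⟨-, hs⟩, hh⟩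
    exact eq_one_of_mem_range_regularRep e hh hs

end RegularRep

lemma sign_mulLeft_prod_snd {A B : Type*} [Group A] [Group B] [Fintype A] [Fintype B]
    [DecidableEq A] [DecidableEq B] (hA : Even (Fintype.card A)) (b : B) :
    Perm.sign (Equiv.mulLeft ((1, b) : A × B)) = 1 := by
  have : Equiv.mulLeft ((1, b) : A × B) = Equiv.prodCongrRight fun _ => Equiv.mulLeft b := by
    ext x <;> simp
  rw [this, Perm.sign_prodCongrRight]
  obtain ⟨m, hm⟩ := hA
  simp [hm, ← two_mul, pow_mul]

lemma sign_mulLeft_prod_fst {A B : Type*} [Group A] [Group B] [Fintype A] [Fintype B]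
    [DecidableEq A] [DecidableEq B] (hB : Even (Fintype.card B)) (a : A) :
    Perm.sign (Equiv.mulLeft ((a, 1) : A × B)) = 1 := by
  have : Equiv.mulLeft ((a, 1) : A × B) = Equiv.prodCongrLeft fun _ => Equiv.mulLeft a := by
    ext x <;> simp
  rw [this, Perm.sign_prodCongrLeft]
  obtain ⟨m, hm⟩ := hB
  simp [hm, ← two_mul, pow_mul]

/-- The rotations and the reflections of a dihedral group, each indexed by `ZMod n`. -/
def dihedralEquiv (n : ℕ) : DihedralGroup n ≃ Bool × ZMod n where
  toFun
    | .r i => (false, i)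
    | .sr i => (true, i)
  invFun
    | (false, i) => .r i
    | (true, i) => .sr i
  left_inv x := by cases x <;> rfl
  right_inv x := by rcases x with ⟨_ | _, i⟩ <;> rfl

lemma sign_mulLeft_dihedralGroup_r (n : ℕ) [NeZero n] (i : ZMod n) :
    Perm.sign (Equiv.mulLeft (DihedralGroup.r i)) = 1 := by
  have : (dihedralEquiv n).permCongr (Equiv.mulLeft (DihedralGroup.r i)) =
      Equiv.prodCongrRight fun b => bif b then (Equiv.addLeft i)⁻¹ else Equiv.addLeft i := by
    ext ⟨_ | _, j⟩ <;> simp [dihedralEquiv, sub_eq_neg_add]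
  rw [← Perm.sign_permCongr (dihedralEquiv n), this, Perm.sign_prodCongrRight,
    Fintype.prod_bool]
  exact (congrArg (· * _) (Perm.sign_inv _)).trans (Int.units_mul_self _)

lemma sign_mulLeft_dihedralGroup_sr_zero (n : ℕ) [NeZero n] (hn : Even n) :
    Perm.sign (Equiv.mulLeft (DihedralGroup.sr (0 : ZMod n))) = 1 := by
  have : (dihedralEquiv n).permCongr (Equiv.mulLeft (DihedralGroup.sr (0 : ZMod n))) =
      Equiv.prodCongrLeft fun _ => Equiv.boolNot := by
    ext ⟨_ | _, j⟩ <;> simp [dihedralEquiv]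
  rw [← Perm.sign_permCongr (dihedralEquiv n), this, Perm.sign_prodCongrLeft]
  obtain ⟨m, hm⟩ := hn
  simp [ZMod.card, hm, ← two_mul, pow_mul]

lemma range_regularRep_dihedralGroup_le {n : ℕ} [NeZero n] (hn : Even n) {X : Type*} [Fintype X]
    [DecidableEq X] (e : DihedralGroup n ≃ X) : (regularRep e).range ≤ alternatingGroup X := by
  have hr (i : ZMod n) : regularRep e (.r i) ∈ alternatingGroup X := by
    rw [Perm.mem_alternatingGroup, sign_regularRep, sign_mulLeft_dihedralGroup_r]
  rintro _ ⟨i | i, rfl⟩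
  · exact hr i
  · have : DihedralGroup.sr i = DihedralGroup.sr 0 * DihedralGroup.r i := by simp
    rw [this, map_mul]
    refine mul_mem ?_ (hr i)
    rw [Perm.mem_alternatingGroup, sign_regularRep, sign_mulLeft_dihedralGroup_sr_zero n hn]

lemma exists_not_commute_dihedralGroup {n : ℕ} (hn : 2 < n) :
    ∃ a b : DihedralGroup n, a * b ≠ b * a := by
  refine ⟨.r 1, .sr 0, ?_⟩
  have : Fact (2 < n) := ⟨hn⟩
  simpa using ZMod.neg_one_ne_one (n := n)

lemma exists_ofAdd_one_zpow_eq {n : ℕ} (b : Multiplicative (ZMod n)) :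
    ∃ z : ℤ, (Multiplicative.ofAdd (1 : ZMod n)) ^ z = b := by
  obtain ⟨z, hz⟩ := ZMod.intCast_surjective b.toAdd
  refine ⟨z, ?_⟩
  rw [← ofAdd_zsmul]
  simp [hz]

lemma closure_generators_zmod_prod (m n : ℕ) :
    Subgroup.closure {((1, .ofAdd 1) : Multiplicative (ZMod m) × Multiplicative (ZMod n)),
      (.ofAdd 1, 1)} = ⊤ := by
  rw [eq_top_iff]
  rintro ⟨a, b⟩ -
  obtain ⟨x, rfl⟩ := exists_ofAdd_one_zpow_eq a
  obtain ⟨y, rfl⟩ := exists_ofAdd_one_zpow_eq b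
  have hx : ((.ofAdd 1, 1) : Multiplicative (ZMod m) × Multiplicative (ZMod n)) ∈
      Subgroup.closure {(1, .ofAdd 1), (.ofAdd 1, 1)} := Subgroup.subset_closure (Or.inr rfl)
  have hy : ((1, .ofAdd 1) : Multiplicative (ZMod m) × Multiplicative (ZMod n)) ∈
      Subgroup.closure {(1, .ofAdd 1), (.ofAdd 1, 1)} := Subgroup.subset_closure (Or.inl rfl)
  have := mul_mem (zpow_mem hx x) (zpow_mem hy y)
  simpa using this

/-- There is a bijection placing `(a, b)` at position `a * n + b`. -/
lemma exists_equiv_zmod_prod (n k : ℕ) [NeZero n] (h : 2 * n = k) :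
    ∃ e : Multiplicative (ZMod 2) × Multiplicative (ZMod n) ≃ Fin k,
      ∀ a b, (e (a, b) : ℕ) = a.toAdd.val * n + b.toAdd.val := by
  subst h
  let f : Multiplicative (ZMod 2) × Multiplicative (ZMod n) → Fin (2 * n) := fun x =>
    ⟨x.1.toAdd.val * n + x.2.toAdd.val, by
      have h1 := ZMod.val_lt x.1.toAdd
      have h2 := ZMod.val_lt x.2.toAdd
      nlinarith⟩
  have hf : Function.Bijective f := by
    rw [Fintype.bijective_iff_injective_and_card]
    refine ⟨?_, by simp [ZMod.card]⟩
    rintro ⟨a, b⟩ ⟨c, d⟩ h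
    have h : a.toAdd.val * n + b.toAdd.val = c.toAdd.val * n + d.toAdd.val := congrArg Fin.val h
    have hb := ZMod.val_lt b.toAdd
    have hd := ZMod.val_lt d.toAdd
    have hn : 0 < n := Nat.pos_of_neZero n
    have h1 := congrArg (· % n) h
    simp only [Nat.mul_add_mod_self_right, Nat.mod_eq_of_lt hb, Nat.mod_eq_of_lt hd] at h1
    have h2 : a.toAdd.val = c.toAdd.val := by
      rw [h1] at h
      exact Nat.eq_of_mul_eq_mul_right hn (Nat.add_right_cancel h)
    exact Prod.ext (ZMod.val_injective _ h2) (ZMod.val_injective _ h1)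
  exact ⟨Equiv.ofBijective f hf, fun _ _ => rfl⟩

/-- Let `σ' = (1,2,…,2k)(2k+1,…,4k)` and `τ' = (1,2k+1)(2,2k+2)⋯(2k,4k)` in the
alternating group `A_{4k}` (realized on `Fin (4k)`, `0`-indexed, with `A_{4k−1}` the
subgroup of `A_{4k}` fixing the last point). Then `σ'τ' = τ'σ'`, the subgroup
`⟨σ', τ'⟩` is isomorphic to `C₂ × C_{2k}`, and `A_{4k}` factorizes through `A_{4k−1}` and
`⟨σ', τ'⟩`. Consequently, for `k ≥ 2` the factorization index satisfies
`[A_{4k} : A_{4k−1}]^f ≥ 2`: there exist two `A_{4k−1}`-complements of `A_{4k}` which are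
not isomorphic. -/
theorem stmt5 (k : ℕ) (hk : 0 < k)
    (p : Fin (4 * k)) (hp : (p : ℕ) = 4 * k - 1)
    (σ' τ' : Equiv.Perm (Fin (4 * k)))
    (hσ' : ∀ j : Fin (4 * k), ((σ' j : Fin (4 * k)) : ℕ) =
      if (j : ℕ) = 2 * k - 1 then 0
      else if (j : ℕ) = 4 * k - 1 then 2 * k
      else (j : ℕ) + 1)
    (hτ' : ∀ j : Fin (4 * k), ((τ' j : Fin (4 * k)) : ℕ) = ((j : ℕ) + 2 * k) % (4 * k)) :
    σ' * τ' = τ' * σ' ∧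
    σ' ∈ alternatingGroup (Fin (4 * k)) ∧
    τ' ∈ alternatingGroup (Fin (4 * k)) ∧
    Subgroup.closure {σ', τ'} ≤ alternatingGroup (Fin (4 * k)) ∧
    Nonempty (↥(Subgroup.closure {σ', τ'}) ≃*
      (Multiplicative (ZMod 2) × Multiplicative (ZMod (2 * k)))) ∧
    (∀ g ∈ alternatingGroup (Fin (4 * k)),
      ∃ a ∈ alternatingGroup (Fin (4 * k)) ⊓
          MulAction.stabilizer (Equiv.Perm (Fin (4 * k))) p,
        ∃ h ∈ Subgroup.closure {σ', τ'}, g = a * h) ∧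
    (alternatingGroup (Fin (4 * k)) ⊓
        MulAction.stabilizer (Equiv.Perm (Fin (4 * k))) p) ⊓
      Subgroup.closure {σ', τ'} = ⊥ ∧
    (2 ≤ k →
      ∃ H₁ H₂ : Subgroup (Equiv.Perm (Fin (4 * k))),
        H₁ ≤ alternatingGroup (Fin (4 * k)) ∧
        H₂ ≤ alternatingGroup (Fin (4 * k)) ∧
        (∀ g ∈ alternatingGroup (Fin (4 * k)),
          ∃ a ∈ alternatingGroup (Fin (4 * k)) ⊓
              MulAction.stabilizer (Equiv.Perm (Fin (4 * k))) p,
            ∃ h ∈ H₁, g = a * h) ∧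
        (alternatingGroup (Fin (4 * k)) ⊓
            MulAction.stabilizer (Equiv.Perm (Fin (4 * k))) p) ⊓ H₁ = ⊥ ∧
        (∀ g ∈ alternatingGroup (Fin (4 * k)),
          ∃ a ∈ alternatingGroup (Fin (4 * k)) ⊓
              MulAction.stabilizer (Equiv.Perm (Fin (4 * k))) p,
            ∃ h ∈ H₂, g = a * h) ∧
        (alternatingGroup (Fin (4 * k)) ⊓
            MulAction.stabilizer (Equiv.Perm (Fin (4 * k))) p) ⊓ H₂ = ⊥ ∧
        ¬ Nonempty (H₁ ≃* H₂)) := by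
  have : NeZero (2 * k) := ⟨by omega⟩
  obtain ⟨e, he⟩ := exists_equiv_zmod_prod (2 * k) (4 * k) (by ring)
  have : Fact (1 < 2 * k) := ⟨by omega⟩
  have hσ : σ' = regularRep e (1, .ofAdd 1) := by
    refine eq_regularRep e ?_
    rintro ⟨a, b⟩
    have ha := ZMod.val_lt a.toAdd
    have hb := ZMod.val_lt b.toAdd
    refine Fin.ext ?_
    rw [hσ', Prod.mk_mul_mk, he, he, one_mul, toAdd_mul, toAdd_ofAdd, ZMod.val_add,
      ZMod.val_one]
    generalize a.toAdd.val = u at *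
    generalize b.toAdd.val = v at *
    rcases Nat.lt_or_ge (1 + v) (2 * k) with h | h
    · rw [Nat.mod_eq_of_lt h]
      interval_cases u <;> split_ifs <;> omega
    · have : 1 + v = 2 * k := by omega
      rw [this, Nat.mod_self]
      interval_cases u <;> split_ifs <;> omega
  have hτ : τ' = regularRep e (.ofAdd 1, 1) := by
    refine eq_regularRep e ?_
    rintro ⟨a, b⟩
    have ha := ZMod.val_lt a.toAdd
    have hb := ZMod.val_lt b.toAdd
    refine Fin.ext ?_
    rw [hτ', Prod.mk_mul_mk, he, he, one_mul, toAdd_mul, toAdd_ofAdd, ZMod.val_add,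
      ZMod.val_one]
    generalize a.toAdd.val = u at *
    generalize b.toAdd.val = v at *
    interval_cases u
    · rw [Nat.mod_eq_of_lt (by omega)]
      omega
    · rw [show 1 * (2 * k) + v + 2 * k = v + 4 * k by ring, Nat.add_mod_right,
        Nat.mod_eq_of_lt (by omega)]
      omega
  have hcl : Subgroup.closure {σ', τ'} = (regularRep e).range := by
    rw [MonoidHom.range_eq_map, ← closure_generators_zmod_prod, MonoidHom.map_closure,
      Set.image_pair, hσ, hτ]
  have hσA : σ' ∈ alternatingGroup (Fin (4 * k)) := by
    rw [Perm.mem_alternatingGroup, hσ, sign_regularRep, sign_mulLeft_prod_snd]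
    simp [ZMod.card]
  have hτA : τ' ∈ alternatingGroup (Fin (4 * k)) := by
    rw [Perm.mem_alternatingGroup, hτ, sign_regularRep, sign_mulLeft_prod_fst]
    simp [ZMod.card]
  have hle : Subgroup.closure {σ', τ'} ≤ alternatingGroup (Fin (4 * k)) := by
    rw [Subgroup.closure_le]
    rintro _ (rfl | rfl) <;> assumption
  have hcompl := range_regularRep_complement e _ (hcl ▸ hle) p
  have hcomm : σ' * τ' = τ' * σ' := by
    rw [hσ, hτ, ← map_mul, ← map_mul]
    exact congrArg _ (mul_comm _ _)
  refine ⟨hcomm, hσA, hτA, hle, ?_⟩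
  rw [hcl] at hle ⊢
  let E := MonoidHom.ofInjective (regularRep_injective e)
  refine ⟨⟨E.symm⟩, hcompl.1, hcompl.2, fun hk2 => ?_⟩
  have hcard : Fintype.card (DihedralGroup (2 * k)) = Fintype.card (Fin (4 * k)) := by
    rw [DihedralGroup.card, Fintype.card_fin]
    ring
  let d := Fintype.equivOfCardEq hcard
  have hd := range_regularRep_dihedralGroup_le (even_two_mul k) d
  have hdc := range_regularRep_complement d _ hd p
  refine ⟨_, _, hle, hd, hcompl.1, hcompl.2, hdc.1, hdc.2, ?_⟩
  rintro ⟨f⟩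
  obtain ⟨a, b, hab⟩ := exists_not_commute_dihedralGroup (n := 2 * k) (by omega)
  let F := ((MonoidHom.ofInjective (regularRep_injective d)).trans f.symm).trans E.symm
  exact hab (F.injective (by rw [map_mul, map_mul]; exact mul_comm _ _))
end

section
/- Let (A, H, ▷, ◁) be a matched pair of groups and r : H → A a deformation map. Then the set H equipped with the new multiplication h • g := (h ◁ r(g))g is a group H_r (the r-deformation of H), with the same unit 1 as H, in which the inverse of h is h^{-1} ◁ r(h)^{-1}. -/
/-- A deformation map of the matched pair: `r(1) = 1` and
`r((h ◁ r(g)) g) = r(h) (h ▷ r(g))`. -/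
def MatchedPair.IsDeformationMap {A H : Type*} [Group A] [Group H]
    (mp : MatchedPair A H) (r : H → A) : Prop :=
  r 1 = 1 ∧ ∀ h g, r (mp.tl h (r g) * g) = r h * mp.tr h (r g)

/-- The deformed multiplication `h • g = (h ◁ r(g)) g` on `H`. -/
def MatchedPair.dmul {A H : Type*} [Group A] [Group H]
    (mp : MatchedPair A H) (r : H → A) (h g : H) : H :=
  mp.tl h (r g) * g

namespace MatchedPair

variable {A H : Type*} [Group A] [Group H] (mp : MatchedPair A H) {r : H → A}

theorem one_tl (a : A) : mp.tl 1 a = 1 := by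
  have h := mp.compat_tl 1 1 a
  rw [mp.tr_one_act, mul_one] at h
  exact left_eq_mul.mp h

theorem dmul_assoc (hr : mp.IsDeformationMap r) (h g t : H) :
    mp.dmul r (mp.dmul r h g) t = mp.dmul r h (mp.dmul r g t) := by
  simp only [dmul, hr.2, mp.compat_tl, mp.tl_mul_act, mul_assoc]

theorem one_dmul (h : H) : mp.dmul r 1 h = h := by
  rw [dmul, one_tl, one_mul]

theorem dmul_one (hr : mp.IsDeformationMap r) (h : H) : mp.dmul r h 1 = h := by
  rw [dmul, hr.1, mp.tl_one_act, mul_one]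

theorem inv_dmul_cancel (h : H) : mp.dmul r (mp.tl h⁻¹ (r h)⁻¹) h = 1 := by
  rw [dmul, ← mp.tl_mul_act, inv_mul_cancel, mp.tl_one_act, inv_mul_cancel]

theorem dmul_inv_cancel (hr : mp.IsDeformationMap r) (h : H) :
    mp.dmul r h (mp.tl h⁻¹ (r h)⁻¹) = 1 := by
  have key := mp.dmul_assoc hr
    (mp.tl (mp.tl h⁻¹ (r h)⁻¹)⁻¹ (r (mp.tl h⁻¹ (r h)⁻¹))⁻¹) (mp.tl h⁻¹ (r h)⁻¹) h
  rw [inv_dmul_cancel, inv_dmul_cancel, one_dmul, mp.dmul_one hr] at key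
  conv_lhs => enter [3]; rw [key]
  exact mp.inv_dmul_cancel _

end MatchedPair

/-- For a matched pair `(A, H, ▷, ◁)` and a deformation map `r : H → A`, the set `H` with
the multiplication `h • g = (h ◁ r(g)) g` is a group `H_r` with the same unit `1` as `H`,
in which the inverse of `h` is `h⁻¹ ◁ r(h)⁻¹`. -/
theorem stmt6 {A H : Type*} [Group A] [Group H] (mp : MatchedPair A H)
    (r : H → A) (hr : mp.IsDeformationMap r) :
    (∀ h g t : H, mp.dmul r (mp.dmul r h g) t = mp.dmul r h (mp.dmul r g t)) ∧
    (∀ h : H, mp.dmul r 1 h = h) ∧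
    (∀ h : H, mp.dmul r h 1 = h) ∧
    (∀ h : H, mp.dmul r (mp.tl h⁻¹ (r h)⁻¹) h = 1 ∧
      mp.dmul r h (mp.tl h⁻¹ (r h)⁻¹) = 1) := by
  exact ⟨mp.dmul_assoc hr, mp.one_dmul, mp.dmul_one hr,
    fun h => ⟨mp.inv_dmul_cancel h, mp.dmul_inv_cancel hr h⟩⟩
end

section
/- Let A ≤ G be a subgroup of a group G, let H be a given A-complement of G, and let (A, H, ▷, ◁) be the canonical matched pair associated to the factorization G = AH. Then a group ℍ is isomorphic to an A-complement of G if and only if ℍ is isomorphic to H_r for some deformation map r : H → A of (A, H, ▷, ◁). -/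
/-- Factorizations along two subgroups with trivial intersection are unique. -/
theorem Subgroup.mul_eq_mul_iff_of_inf_eq_bot {G : Type*} [Group G] {A H : Subgroup G}
    (hint : A ⊓ H = ⊥) {a b : A} {h k : H} :
    (a : G) * h = b * k ↔ a = b ∧ h = k := by
  constructor
  · intro he
    have hab : ((a, h) : A × H) = (b, k) :=
      Subgroup.mul_injective_of_disjoint (disjoint_iff.mpr hint) he
    simpa using hab
  · rintro ⟨rfl, rfl⟩
    rfl


/-- Let `A ≤ G`, let `H` be an `A`-complement of `G` (`G = AH`, `A ∩ H = 1`) and let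
`(A, H, ▷, ◁)` be the canonical matched pair of the factorization `G = AH`, i.e. the pair
determined by `h a = (h ▷ a)(h ◁ a)`. Then a group `ℍ` is isomorphic to an `A`-complement
of `G` if and only if `ℍ` is isomorphic to the `r`-deformation `H_r` (the set `H` with
multiplication `h • g = (h ◁ r(g)) g`) for some deformation map `r : H → A` of the
canonical matched pair. -/
theorem stmt9 {G : Type*} [Group G] (A H : Subgroup G)
    (hfact : ∀ g : G, ∃ a ∈ A, ∃ h ∈ H, g = a * h) (hint : A ⊓ H = ⊥)
    (tr : H → A → A) (tl : H → A → H)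
    (hcanon : ∀ (h : H) (a : A), (h : G) * (a : G) = (tr h a : G) * (tl h a : G))
    (ℍ : Type*) [Group ℍ] :
    (∃ K : Subgroup G, (∀ g : G, ∃ a ∈ A, ∃ h ∈ K, g = a * h) ∧ A ⊓ K = ⊥ ∧
      Nonempty (ℍ ≃* K)) ↔
    (∃ r : H → A, r 1 = 1 ∧ (∀ h g : H, r (tl h (r g) * g) = r h * tr h (r g)) ∧
      ∃ f : ℍ → H, Function.Bijective f ∧
        ∀ x y : ℍ, f (x * y) = tl (f x) (r (f y)) * f y) := by
  have huniq {a b : A} {h k : H} (he : (a : G) * h = b * k) : a = b ∧ h = k :=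
    (Subgroup.mul_eq_mul_iff_of_inf_eq_bot hint).mp he
  have hmul (r : H → A) (h g : H) :
      ((r h : G) * h) * (r g * g) = (r h * tr h (r g) : A) * (tl h (r g) * g : H) := by
    calc ((r h : G) * h) * (r g * g) = r h * (h * r g) * g := by group
      _ = _ := by rw [hcanon]; push_cast; group
  constructor
  · rintro ⟨K, hK, hAK, ⟨e⟩⟩
    have hr (h : H) : ∃ a : A, (a : G) * h ∈ K := by
      obtain ⟨a, ha, k, hk, he⟩ := hK h
      exact ⟨⟨a⁻¹, A.inv_mem ha⟩, by simpa [he] using hk⟩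
    choose r hr using hr
    have hr_eq {a : A} {h : H} (ha : (a : G) * h ∈ K) : a = r h := by
      have hA : (a : G) * (r h : G)⁻¹ ∈ A ⊓ K := by
        refine ⟨A.mul_mem a.2 (A.inv_mem (r h).2), ?_⟩
        simpa [mul_assoc] using K.mul_mem ha (K.inv_mem (hr h))
      rw [hAK, Subgroup.mem_bot, mul_inv_eq_one] at hA
      exact Subtype.ext hA
    have hf (x : ℍ) : ∃ h : H, (e x : G) = r h * h := by
      obtain ⟨a, ha, h, hh, he⟩ := hfact (e x)
      have har := hr_eq (a := ⟨a, ha⟩) (h := ⟨h, hh⟩) (he ▸ (e x).2)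
      exact ⟨⟨h, hh⟩, by rw [he, ← har]⟩
    choose f hf using hf
    refine ⟨r, (hr_eq (by simp)).symm, fun h g => (hr_eq ?_).symm, f, ⟨?_, ?_⟩, ?_⟩
    · rw [← hmul]
      exact K.mul_mem (hr h) (hr g)
    · intro x y hxy
      apply e.injective
      apply Subtype.ext
      rw [hf, hf, hxy]
    · intro h
      obtain ⟨x, hx⟩ := e.surjective ⟨_, hr h⟩
      exact ⟨x, (huniq (a := r (f x)) (b := r h) (by rw [← hf, hx])).2⟩
    · intro x y
      refine (huniq (a := r (f (x * y))) (b := r (f x) * tr (f x) (r (f y))) ?_).2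
      rw [← hmul, ← hf, ← hf, ← hf, map_mul, Subgroup.coe_mul]
  · rintro ⟨r, hr1, hr, f, hf, hfmul⟩
    let φ : ℍ →* G := MonoidHom.mk' (fun x => (r (f x) : G) * f x) fun x y => by
      rw [hmul, hfmul, hr]
    have hφ (x : ℍ) : φ x = r (f x) * f x := rfl
    have hinj : Function.Injective φ := fun x y hxy => hf.1 (huniq hxy).2
    refine ⟨φ.range, fun g => ?_, ?_, ⟨MonoidHom.ofInjective hinj⟩⟩
    · obtain ⟨a, ha, h, hh, rfl⟩ := hfact g
      obtain ⟨x, hx⟩ := hf.2 ⟨h, hh⟩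
      refine ⟨a * (r (f x) : G)⁻¹, A.mul_mem ha (A.inv_mem (r (f x)).2), φ x, ⟨x, rfl⟩, ?_⟩
      simp [hφ, hx, mul_assoc]
    · rw [eq_bot_iff]
      rintro _ ⟨hA, x, rfl⟩
      have hfx : f x = 1 :=
        (huniq (a := r (f x)) (b := ⟨φ x, hA⟩) (k := 1) (by simp [hφ])).2
      rw [Subgroup.mem_bot, hφ, hfx, hr1]
      simp
end

section
/- In the symmetric group S_4, let S_3 be the subgroup fixing the point 4, let C_4 = ⟨(1 2 3 4)⟩, and let V = {e, (1 2)(3 4), (1 3)(2 4), (1 4)(2 3)} be the Klein four-subgroup. Then both C_4 and V are S_3-complements of S_4 (i.e. S_4 = S_3·C_4 = S_3·V with trivial intersections), they are not isomorphic, every S_3-complement of S_4 is isomorphic to C_4 or to V, and hence the factorization index [S_4 : S_3]^f = 2. -/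
/-- `S₃`, the subgroup of `S₄ = Perm (Fin 4)` fixing the (0-indexed) point `3`. -/
def S₃ : Subgroup (Equiv.Perm (Fin 4)) :=
  MulAction.stabilizer (Equiv.Perm (Fin 4)) (3 : Fin 4)

/-- The cyclic subgroup `C₄ = ⟨(1 2 3 4)⟩` of `S₄`. -/
def C₄ : Subgroup (Equiv.Perm (Fin 4)) :=
  Subgroup.zpowers (finRotate 4)

/-- The Klein four-subgroup `V = {e, (12)(34), (13)(24), (14)(23)}` of `S₄`. -/
def V : Subgroup (Equiv.Perm (Fin 4)) :=
  Subgroup.closure {Equiv.swap 0 1 * Equiv.swap 2 3, Equiv.swap 0 2 * Equiv.swap 1 3}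

/-- The subtype of `S₃`-complements of `S₄`. -/
def ComplS₄ : Type :=
  {K : Subgroup (Equiv.Perm (Fin 4)) //
    (∀ g : Equiv.Perm (Fin 4), ∃ a ∈ S₃, ∃ h ∈ K, g = a * h) ∧ S₃ ⊓ K = ⊥}

/-- Isomorphism of `S₃`-complements; `Quot complRelS₄` is `F(S₃, S₄)` and its cardinality
is the factorization index `[S₄ : S₃]^f`. -/
def complRelS₄ (K L : ComplS₄) : Prop :=
  Nonempty (K.val ≃* L.val)

open scoped Pointwise in
theorem isComplement'_iff_forall_exists_mul {G : Type*} [Group G] {H K : Subgroup G} :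
    H.IsComplement' K ↔ (∀ g : G, ∃ a ∈ H, ∃ k ∈ K, g = a * k) ∧ H ⊓ K = ⊥ := by
  constructor
  · intro h
    refine ⟨fun g ↦ ?_, h.disjoint.eq_bot⟩
    obtain ⟨⟨a, k⟩, hak⟩ := h.2 g
    exact ⟨a, a.2, k, k.2, hak.symm⟩
  · rintro ⟨hmul, hbot⟩
    refine Subgroup.isComplement'_of_disjoint_and_mul_eq_univ (disjoint_iff.mpr hbot) ?_
    refine Set.eq_univ_of_forall fun g ↦ ?_
    obtain ⟨a, ha, k, hk, rfl⟩ := hmul g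
    exact Set.mul_mem_mul ha hk

theorem isComplement'_S₃_of_forall_mem_iff {K : Subgroup (Equiv.Perm (Fin 4))}
    (s : Finset (Equiv.Perm (Fin 4))) (hs : ∀ g, g ∈ K ↔ g ∈ s)
    (hfree : ∀ k ∈ s, k 3 = 3 → k = 1) (htrans : ∀ i, ∃ k ∈ s, k i = 3) :
    S₃.IsComplement' K := by
  refine (Subgroup.isComplement'_stabilizer (3 : Fin 4) ?_ ?_).symm
  · exact fun k hk ↦ Subtype.ext (hfree k ((hs k).mp k.2) hk)
  · intro g
    obtain ⟨k, hk, hki⟩ := htrans (g 3)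
    exact ⟨⟨k, (hs k).mpr hk⟩, hki⟩

theorem natCard_eq_four_of_isComplement'_S₃ {K : Subgroup (Equiv.Perm (Fin 4))}
    (h : S₃.IsComplement' K) : Nat.card K = 4 := by
  rw [← h.symm.index_eq_card, S₃, MulAction.index_stabilizer_of_transitive, Nat.card_fin]

theorem mem_C₄_iff (g : Equiv.Perm (Fin 4)) :
    g ∈ C₄ ↔ g ∈ (Finset.range 4).image (finRotate 4 ^ ·) := by
  have h : orderOf (finRotate 4) = 2 ^ (1 + 1) :=
    orderOf_eq_prime_pow (by decide) (by decide)
  rw [C₄, mem_zpowers_iff_mem_range_orderOf, h]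
  rfl

theorem isComplement'_S₃_C₄ : S₃.IsComplement' C₄ :=
  isComplement'_S₃_of_forall_mem_iff _ mem_C₄_iff (by decide) (by decide)

/-- The elements of the Klein four-subgroup `V`. -/
def kleinFourFinset : Finset (Equiv.Perm (Fin 4)) :=
  {1, Equiv.swap 0 1 * Equiv.swap 2 3, Equiv.swap 0 2 * Equiv.swap 1 3,
    Equiv.swap 0 3 * Equiv.swap 1 2}

theorem mem_V_iff (g : Equiv.Perm (Fin 4)) : g ∈ V ↔ g ∈ kleinFourFinset := by
  constructor
  · intro hg
    induction hg using Subgroup.closure_induction with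
    | mem x hx =>
      rcases hx with rfl | rfl <;> decide
    | one => decide
    | mul x y _ _ hx hy =>
      have hmul : ∀ x ∈ kleinFourFinset, ∀ y ∈ kleinFourFinset, x * y ∈ kleinFourFinset := by
        decide
      exact hmul x hx y hy
    | inv x _ hx =>
      have hinv : ∀ x ∈ kleinFourFinset, x⁻¹ ∈ kleinFourFinset := by decide
      exact hinv x hx
  · have ha : Equiv.swap 0 1 * Equiv.swap 2 3 ∈ V := Subgroup.subset_closure (by simp)
    have hb : Equiv.swap 0 2 * Equiv.swap 1 3 ∈ V := Subgroup.subset_closure (by simp)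
    have hc : (Equiv.swap 0 3 * Equiv.swap 1 2 : Equiv.Perm (Fin 4)) =
        (Equiv.swap 0 1 * Equiv.swap 2 3) * (Equiv.swap 0 2 * Equiv.swap 1 3) := by decide
    simp only [kleinFourFinset, Finset.mem_insert, Finset.mem_singleton]
    rintro (rfl | rfl | rfl | rfl)
    · exact one_mem V
    · exact ha
    · exact hb
    · exact hc ▸ mul_mem ha hb

theorem isComplement'_S₃_V : S₃.IsComplement' V :=
  isComplement'_S₃_of_forall_mem_iff _ mem_V_iff (by decide) (by decide)

instance isCyclic_C₄ : IsCyclic C₄ :=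
  inferInstanceAs (IsCyclic (Subgroup.zpowers (finRotate 4)))

instance isKleinFour_V : IsKleinFour V where
  card_four := natCard_eq_four_of_isComplement'_S₃ isComplement'_S₃_V
  exponent_two := by
    have hcard := natCard_eq_four_of_isComplement'_S₃ isComplement'_S₃_V
    have : Nontrivial V := Finite.one_lt_card_iff_nontrivial.mp (by omega)
    have hsq : ∀ g ∈ kleinFourFinset, g ^ 2 = 1 := by decide
    refine (Nat.prime_two.eq_one_or_self_of_dvd _ (Monoid.exponent_dvd_of_forall_pow_eq_one
      fun g ↦ Subtype.ext (hsq g ((mem_V_iff g).mp g.2)))).resolve_left fun h ↦ ?_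
    exact not_subsingleton V (Monoid.exp_eq_one_iff.mp h)

theorem not_nonempty_C₄_mulEquiv_V : ¬ Nonempty (C₄ ≃* V) := by
  rintro ⟨e⟩
  exact IsKleinFour.not_isCyclic (G := V) (e.isCyclic.mp inferInstance)

/-- A group of order four is either cyclic or a Klein four-group. -/
theorem isCyclic_or_isKleinFour {G : Type*} [Group G] (h : Nat.card G = 4) :
    IsCyclic G ∨ IsKleinFour G :=
  or_iff_not_imp_left.mpr fun hc ↦
    ⟨h, (not_isCyclic_iff_exponent_eq_prime Nat.prime_two h).mp hc⟩

theorem nonempty_mulEquiv_C₄_or_V {K : Subgroup (Equiv.Perm (Fin 4))}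
    (h : S₃.IsComplement' K) : Nonempty (K ≃* C₄) ∨ Nonempty (K ≃* V) := by
  have hcard := natCard_eq_four_of_isComplement'_S₃ h
  rcases isCyclic_or_isKleinFour hcard with _ | _
  · exact .inl ⟨mulEquivOfCyclicCardEq
      (hcard.trans (natCard_eq_four_of_isComplement'_S₃ isComplement'_S₃_C₄).symm)⟩
  · exact .inr IsKleinFour.nonempty_mulEquiv

theorem complRelS₄_equivalence : Equivalence complRelS₄ where
  refl _ := ⟨MulEquiv.refl _⟩
  symm := fun ⟨e⟩ ↦ ⟨e.symm⟩
  trans := fun ⟨e⟩ ⟨f⟩ ↦ ⟨e.trans f⟩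

theorem mk_quot_complRelS₄ : Cardinal.mk (Quot complRelS₄) = 2 := by
  refine Cardinal.mk_eq_two_iff.mpr
    ⟨Quot.mk _ ⟨C₄, isComplement'_iff_forall_exists_mul.mp isComplement'_S₃_C₄⟩,
      Quot.mk _ ⟨V, isComplement'_iff_forall_exists_mul.mp isComplement'_S₃_V⟩, ?_, ?_⟩
  · intro h
    exact not_nonempty_C₄_mulEquiv_V (complRelS₄_equivalence.quot_mk_eq_iff _ _ |>.mp h)
  · refine Set.eq_univ_of_forall ?_
    rintro ⟨K, hK⟩
    exact (nonempty_mulEquiv_C₄_or_V (isComplement'_iff_forall_exists_mul.mpr hK)).imp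
      (Quot.sound ·) (Quot.sound ·)

/-- Both `C₄` and the Klein four-group `V` are `S₃`-complements of `S₄`, they are not
isomorphic, every `S₃`-complement of `S₄` is isomorphic to `C₄` or to `V`, and hence the
factorization index `[S₄ : S₃]^f = 2`. -/
theorem stmt15 :
    ((∀ g : Equiv.Perm (Fin 4), ∃ a ∈ S₃, ∃ h ∈ C₄, g = a * h) ∧ S₃ ⊓ C₄ = ⊥) ∧
    ((∀ g : Equiv.Perm (Fin 4), ∃ a ∈ S₃, ∃ h ∈ V, g = a * h) ∧ S₃ ⊓ V = ⊥) ∧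
    ¬ Nonempty (C₄ ≃* V) ∧
    (∀ K : Subgroup (Equiv.Perm (Fin 4)),
      ((∀ g : Equiv.Perm (Fin 4), ∃ a ∈ S₃, ∃ h ∈ K, g = a * h) ∧ S₃ ⊓ K = ⊥) →
      (Nonempty (K ≃* C₄) ∨ Nonempty (K ≃* V))) ∧
    Cardinal.mk (Quot complRelS₄) = 2 := by
  exact ⟨isComplement'_iff_forall_exists_mul.mp isComplement'_S₃_C₄,
    isComplement'_iff_forall_exists_mul.mp isComplement'_S₃_V,
    not_nonempty_C₄_mulEquiv_V,
    fun K hK ↦ nonempty_mulEquiv_C₄_or_V (isComplement'_iff_forall_exists_mul.mpr hK),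
    mk_quot_complRelS₄⟩
end

section
/- Let H be a group of order n and let T : H → Perm(H) be the regular (Cayley) representation, T(h)(x) = hx. Identify Perm(H) with S_n and let S_{n-1} be the stabilizer of the identity element of H. Then T(H) ∩ S_{n-1} = {1} and S_n = S_{n-1}·T(H); that is, T(H) (≅ H) is an S_{n-1}-complement of S_n. Consequently, the factorization index [S_n : S_{n-1}]^f equals the number of isomorphism classes of groups of order n. -/
/-- The regular (Cayley) representation `T : H →* Perm H`, `T(h)(x) = hx`. -/
def regRep (H : Type*) [Group H] : H →* Equiv.Perm H :=
  MulAction.toPermHom H H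

/-- The subgroup of `Perm H` (≅ `S_n`, `n = |H|`) stabilizing the identity of `H`
(≅ `S_{n-1}`). -/
def stabOne (H : Type*) [Group H] : Subgroup (Equiv.Perm H) :=
  MulAction.stabilizer (Equiv.Perm H) (1 : H)

/-- The subtype of `stabOne H`-complements of `Perm H`. -/
def ComplPerm (H : Type*) [Group H] : Type _ :=
  {K : Subgroup (Equiv.Perm H) //
    (∀ g : Equiv.Perm H, ∃ a ∈ stabOne H, ∃ h ∈ K, g = a * h) ∧ stabOne H ⊓ K = ⊥}

/-- Isomorphism of complements; the cardinality of `Quot (complRelPerm H)` is the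
factorization index `[S_n : S_{n-1}]^f`. -/
def complRelPerm (H : Type*) [Group H] (K L : ComplPerm H) : Prop :=
  Nonempty (K.val ≃* L.val)

/-- The multiplication of a group structure `g` on `X`. -/
def mulOf {X : Type*} (g : Group X) : Mul X := letI := g; inferInstance

/-- Two group structures on `Fin n` are isomorphic; the quotient
`Quot (grpRel n)` is the set of isomorphism classes of groups of order `n`. -/
def grpRel (n : ℕ) (g₁ g₂ : Group (Fin n)) : Prop :=
  Nonempty (@MulEquiv (Fin n) (Fin n) (mulOf g₁) (mulOf g₂))

/-- The left regular representation of `G`, transported to permutations of `X` along `e : G ≃ X`. -/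
def transportedRegRep {G X : Type*} [Group G] (e : G ≃ X) : G →* Equiv.Perm X :=
  e.permCongrHom.toMonoidHom.comp (MulAction.toPermHom G G)

theorem transportedRegRep_apply {G X : Type*} [Group G] (e : G ≃ X) (g : G) (x : X) :
    transportedRegRep e g x = e (g * e.symm x) :=
  rfl

theorem transportedRegRep_refl (H : Type*) [Group H] :
    transportedRegRep (Equiv.refl H) = regRep H :=
  rfl

theorem mem_stabOne {H : Type*} [Group H] {σ : Equiv.Perm H} : σ ∈ stabOne H ↔ σ 1 = 1 :=
  Iff.rfl

theorem transportedRegRep_injective {G X : Type*} [Group G] (e : G ≃ X) :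
    Function.Injective (transportedRegRep e) := by
  intro g₁ g₂ h
  have := congrArg (fun σ : Equiv.Perm X => e.symm (σ (e 1))) h
  simpa [transportedRegRep_apply] using this

theorem stabOne_inf_range_transportedRegRep {G H : Type*} [Group G] [Group H] (e : G ≃ H) :
    stabOne H ⊓ (transportedRegRep e).range = ⊥ := by
  rw [eq_bot_iff]
  rintro _ ⟨hσ, g, rfl⟩
  have h1 : e (g * e.symm 1) = 1 := mem_stabOne.1 hσ
  rw [← e.eq_symm_apply, mul_eq_right] at h1
  rw [h1, map_one]
  exact Subgroup.one_mem _

theorem exists_eq_mul_transportedRegRep {G H : Type*} [Group G] [Group H] (e : G ≃ H)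
    (σ : Equiv.Perm H) : ∃ a ∈ stabOne H, ∃ g : G, σ = a * transportedRegRep e g := by
  refine ⟨σ * transportedRegRep e (e.symm (σ⁻¹ 1) * (e.symm 1)⁻¹), ?_,
    (e.symm (σ⁻¹ 1) * (e.symm 1)⁻¹)⁻¹, ?_⟩
  · rw [mem_stabOne, Equiv.Perm.mul_apply, transportedRegRep_apply, inv_mul_cancel_right,
      e.apply_symm_apply]
    exact σ.apply_symm_apply 1
  · rw [mul_assoc, ← map_mul, mul_inv_cancel, map_one, mul_one]

/-- Every group in bijection with `H` is isomorphic to a complement of `stabOne H`. -/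
theorem exists_complPerm_mulEquiv {G H : Type*} [Group G] [Group H] (e : G ≃ H) :
    ∃ K : ComplPerm H, Nonempty (K.val ≃* G) := by
  refine ⟨⟨(transportedRegRep e).range, fun σ => ?_, stabOne_inf_range_transportedRegRep e⟩,
    ⟨(MonoidHom.ofInjective (transportedRegRep_injective e)).symm⟩⟩
  obtain ⟨a, ha, g, h⟩ := exists_eq_mul_transportedRegRep e σ
  exact ⟨a, ha, _, ⟨g, rfl⟩, h⟩

/-- A complement of `stabOne H` acts simply transitively on `H`. -/
theorem ComplPerm.bijective_inv_apply_one {H : Type*} [Group H] (K : ComplPerm H) :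
    Function.Bijective fun k : K.val => (k.val⁻¹ : Equiv.Perm H) 1 := by
  obtain ⟨K, hmul, hinf⟩ := K
  classical
  constructor
  · rintro ⟨k, hk⟩ ⟨l, hl⟩ (h : k⁻¹ 1 = l⁻¹ 1)
    have hmem : k * l⁻¹ ∈ stabOne H ⊓ K := by
      refine ⟨mem_stabOne.2 ?_, K.mul_mem hk (K.inv_mem hl)⟩
      rw [Equiv.Perm.mul_apply, ← h]
      exact k.apply_symm_apply 1
    rw [hinf, Subgroup.mem_bot, mul_inv_eq_one] at hmem
    exact Subtype.ext hmem
  · intro x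
    obtain ⟨a, ha, k, hk, h⟩ := hmul (Equiv.swap 1 x)
    refine ⟨⟨k, hk⟩, ?_⟩
    have hx : a (k x) = 1 := by
      rw [← Equiv.Perm.mul_apply, ← h, Equiv.swap_apply_right]
    have hkx : k x = 1 := a.injective (hx.trans (mem_stabOne.1 ha).symm)
    exact Equiv.Perm.inv_eq_iff_eq.2 hkx.symm

/-- Isomorphism is symmetric, with multiplications that need not be the canonical ones. -/
theorem nonempty_mulEquiv_symm {A B : Type*} {mA : Mul A} {mB : Mul B}
    (h : Nonempty (A ≃* B)) : Nonempty (B ≃* A) :=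
  h.map MulEquiv.symm

/-- Isomorphism is transitive, with multiplications that need not be the canonical ones. -/
theorem nonempty_mulEquiv_trans {A B C : Type*} {mA : Mul A} {mB : Mul B} {mC : Mul C}
    (h₁ : Nonempty (A ≃* B)) (h₂ : Nonempty (B ≃* C)) : Nonempty (A ≃* C) :=
  h₁.elim fun i => h₂.map i.trans

/-- Every group structure is carried along a bijection to an isomorphic one. -/
theorem exists_group_mulEquiv {G X : Type*} [Group G] (e : G ≃ X) :
    ∃ γ : Group X, Nonempty (@MulEquiv G X _ (mulOf γ)) :=
  ⟨e.symm.group, ⟨letI := e.symm.group; e.symm.mulEquiv.symm⟩⟩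

/-- Let `H` be a group of order `n` and `T : H → Perm H` the regular representation.
Then `T(H) ∩ S_{n-1} = 1` and `S_n = S_{n-1} · T(H)` (where `S_{n-1}` is the stabilizer of
`1 ∈ H` in `S_n = Perm H`), i.e. `T(H) ≅ H` is an `S_{n-1}`-complement of `S_n`.
Consequently the factorization index `[S_n : S_{n-1}]^f` equals the number of isomorphism
classes of groups of order `n`. -/
theorem stmt16 {H : Type*} [Group H] [Fintype H] (n : ℕ) (hn : Fintype.card H = n) :
    (regRep H).range ⊓ stabOne H = ⊥ ∧
    (∀ g : Equiv.Perm H, ∃ a ∈ stabOne H, ∃ h : H, g = a * regRep H h) ∧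
    Nonempty (H ≃* (regRep H).range) ∧
    Nonempty (Quot (complRelPerm H) ≃ Quot (grpRel n)) := by
  have e : H ≃ Fin n := Fintype.equivFinOfCardEq hn
  refine ⟨?_, ?_, ?_, ?_⟩
  · rw [inf_comm, ← transportedRegRep_refl]
    exact stabOne_inf_range_transportedRegRep _
  · exact exists_eq_mul_transportedRegRep (Equiv.refl H)
  · exact ⟨MonoidHom.ofInjective (transportedRegRep_injective (Equiv.refl H))⟩
  · have toGroup (K : ComplPerm H) :
        ∃ γ : Group (Fin n), Nonempty (@MulEquiv K.val (Fin n) _ (mulOf γ)) :=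
      exists_group_mulEquiv ((Equiv.ofBijective _ K.bijective_inv_apply_one).trans e)
    have toCompl (γ : Group (Fin n)) :
        ∃ K : ComplPerm H, Nonempty (@MulEquiv K.val (Fin n) _ (mulOf γ)) :=
      exists_complPerm_mulEquiv e.symm
    choose f hf using toGroup
    choose g hg using toCompl
    refine ⟨⟨Quot.map f ?_, Quot.map g ?_, ?_, ?_⟩⟩
    · intro K L h
      exact nonempty_mulEquiv_trans (nonempty_mulEquiv_symm (hf K))
        (nonempty_mulEquiv_trans h (hf L))
    · intro γ δ h
      exact nonempty_mulEquiv_trans (hg γ)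
        (nonempty_mulEquiv_trans h (nonempty_mulEquiv_symm (hg δ)))
    · rintro ⟨K⟩
      exact Quot.sound (nonempty_mulEquiv_trans (hg (f K)) (nonempty_mulEquiv_symm (hf K)))
    · rintro ⟨γ⟩
      exact Quot.sound (nonempty_mulEquiv_trans (nonempty_mulEquiv_symm (hf (g γ))) (hg γ))
end

section
/- Let n ≥ 2, let s_i = (i, i+1) ∈ S_n denote the adjacent transpositions, let S_{n-1} ≤ S_n be the subgroup fixing n, let x = s_1 s_2 ⋯ s_{n-1} (an n-cycle) and C_n = ⟨x⟩, so that S_n = S_{n-1} C_n with S_{n-1} ∩ C_n = {1}. Then the canonical matched pair (S_{n-1}, C_n, ▷, ◁) associated to this factorization satisfies: x ▷ s_i = s_{i+1} and x ◁ s_i = x for 1 ≤ i < n−2, while x ▷ s_{n-2} = s_{n-2} s_{n-3} ⋯ s_1 and x ◁ s_{n-2} = x². Equivalently, in S_n one has the identities x s_i = s_{i+1} x for 1 ≤ i < n−2 and x s_{n-2} = (s_{n-2} s_{n-3} ⋯ s_1) x². -/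
theorem val_swap_apply {n : ℕ} (a b i : Fin n) :
    (Equiv.swap a b i : ℕ) = if (i : ℕ) = a then (b : ℕ) else if (i : ℕ) = b then a else i := by
  simp only [Equiv.swap_apply_def, Fin.ext_iff]
  split_ifs <;> rfl

/-- The product `s 1 * ⋯ * s m` of adjacent transpositions is the cycle `0 ↦ 1 ↦ ⋯ ↦ m ↦ 0`. -/
theorem val_prod_adjacent_swaps_apply {n : ℕ} (s : ℕ → Equiv.Perm (Fin n))
    (hs : ∀ i (_ : 1 ≤ i) (_ : i ≤ n - 1),
      s i = Equiv.swap (⟨i - 1, by omega⟩ : Fin n) (⟨i, by omega⟩ : Fin n))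
    (m : ℕ) (hm : m ≤ n - 1) (i : Fin n) :
    ((((List.range m).map fun j => s (j + 1)).prod i : Fin n) : ℕ) =
      if (i : ℕ) < m then (i : ℕ) + 1 else if (i : ℕ) = m then 0 else i := by
  induction m generalizing i with
  | zero => simp +contextual
  | succ m ih =>
    rw [List.range_succ, List.map_append, List.prod_append, List.map_singleton,
      List.prod_singleton, Equiv.Perm.mul_apply, ih (by omega), hs (m + 1) (by omega) hm,
      val_swap_apply]
    simp only [Nat.add_sub_cancel]
    split_ifs <;> omega

/-- The product `s N * s (N - 1) * ⋯ * s (N - m + 1)` of adjacent transpositions is the cycle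
`N ↦ N - 1 ↦ ⋯ ↦ N - m ↦ N`. -/
theorem val_prod_adjacent_swaps_descending_apply {n : ℕ} (s : ℕ → Equiv.Perm (Fin n))
    (hs : ∀ i (_ : 1 ≤ i) (_ : i ≤ n - 1),
      s i = Equiv.swap (⟨i - 1, by omega⟩ : Fin n) (⟨i, by omega⟩ : Fin n))
    (N : ℕ) (hN : N ≤ n - 1) (m : ℕ) (hm : m ≤ N) (i : Fin n) :
    ((((List.range m).map fun j => s (N - j)).prod i : Fin n) : ℕ) =
      if (i : ℕ) = N - m then N
      else if N - m < i ∧ (i : ℕ) ≤ N then (i : ℕ) - 1 else i := by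
  induction m generalizing i with
  | zero =>
    simp only [List.range_zero, List.map_nil, List.prod_nil, Equiv.Perm.one_apply]
    split_ifs <;> omega
  | succ m ih =>
    rw [List.range_succ, List.map_append, List.prod_append, List.map_singleton,
      List.prod_singleton, Equiv.Perm.mul_apply, ih (by omega), hs (N - m) (by omega) (by omega),
      val_swap_apply]
    dsimp only
    split_ifs <;> omega

theorem val_pow_apply_of_val_apply {n : ℕ} {x : Equiv.Perm (Fin n)}
    (hx : ∀ i, (x i : ℕ) = (i + 1) % n) (k : ℕ) (i : Fin n) :
    ((x ^ k) i : ℕ) = (i + k) % n := by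
  induction k with
  | zero => simp [Nat.mod_eq_of_lt i.isLt]
  | succ k ih => rw [pow_succ', Equiv.Perm.mul_apply, hx, ih, Nat.mod_add_mod, Nat.add_assoc]

theorem exists_stabilizer_mul_zpowers_of_val_apply {n : ℕ} {x : Equiv.Perm (Fin n)}
    (hx : ∀ i, (x i : ℕ) = (i + 1) % n) (p : Fin n) (g : Equiv.Perm (Fin n)) :
    ∃ a ∈ MulAction.stabilizer (Equiv.Perm (Fin n)) p, ∃ c ∈ Subgroup.zpowers x, g = a * c := by
  set j := g⁻¹ p with hj
  have hc : (x ^ (n - j + p : ℕ)) j = p := by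
    ext
    rw [val_pow_apply_of_val_apply hx, show (j : ℕ) + (n - j + p) = p + n by omega,
      Nat.add_mod_right, Nat.mod_eq_of_lt p.isLt]
  refine ⟨g * (x ^ (n - j + p : ℕ))⁻¹, ?_, x ^ (n - j + p : ℕ),
    Subgroup.pow_mem _ (Subgroup.mem_zpowers x) _, by group⟩
  rw [MulAction.mem_stabilizer_iff, Equiv.Perm.smul_def, Equiv.Perm.mul_apply,
    Equiv.Perm.inv_eq_iff_eq.mpr hc.symm, hj, ← Equiv.Perm.mul_apply, mul_inv_cancel,
    Equiv.Perm.one_apply]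

theorem stabilizer_disjoint_zpowers_of_val_apply {n : ℕ} {x : Equiv.Perm (Fin n)}
    (hx : ∀ i, (x i : ℕ) = (i + 1) % n) (p : Fin n) :
    Disjoint (MulAction.stabilizer (Equiv.Perm (Fin n)) p) (Subgroup.zpowers x) := by
  rw [Subgroup.disjoint_def]
  intro g hg hgx
  obtain ⟨k, rfl⟩ := mem_powers_iff_mem_zpowers.mpr hgx
  have hk : (p + k) % n = p := by
    rw [← val_pow_apply_of_val_apply hx]
    exact congrArg Fin.val hg
  have hdvd : n ∣ k := by
    have h : (p : ℕ) + k ≡ p + 0 [MOD n] := by simpa [Nat.ModEq, Nat.mod_eq_of_lt p.isLt] using hk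
    exact (Nat.modEq_zero_iff_dvd).mp (Nat.ModEq.add_left_cancel' _ h)
  ext i
  obtain ⟨q, rfl⟩ := hdvd
  simp [val_pow_apply_of_val_apply hx, Nat.mod_eq_of_lt i.isLt]

/-- The components of a factorization through two disjoint subgroups are unique. -/
theorem Subgroup.eq_and_eq_of_mul_eq_of_disjoint {G : Type*} [Group G] {A C : Subgroup G}
    (hd : Disjoint A C) {a a' : A} {c c' : C} (h : (a : G) * c = a' * c') : a = a' ∧ c = c' :=
  Prod.mk.inj (Subgroup.mul_injective_of_disjoint hd (a₁ := (a, c)) (a₂ := (a', c')) h)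

/-- The canonical matched pair of `S_n = S_{n-1} C_n`.  Here `S_n = Perm (Fin n)`
(0-indexed), `s i` (for `1 ≤ i ≤ n-1`) is the adjacent transposition `(i, i+1)`
(1-indexed), i.e. the swap of `i-1` and `i` in `Fin n`; `S_{n-1}` is the stabilizer `A` of
the last point, `x = s 1 * s 2 * ⋯ * s (n-1)` is an `n`-cycle and `C_n = ⟨x⟩`, so that
`S_n = S_{n-1} C_n` with `S_{n-1} ∩ C_n = 1`.  The canonical matched pair
`(S_{n-1}, C_n, ▷, ◁)` (determined by `h a = (h ▷ a)(h ◁ a)`) satisfies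
`x ▷ s i = s (i+1)`, `x ◁ s i = x` for `1 ≤ i < n-2`, and
`x ▷ s (n-2) = s (n-2) s (n-3) ⋯ s 1`, `x ◁ s (n-2) = x²`; equivalently, in `S_n` one has
`x * s i = s (i+1) * x` for `1 ≤ i < n-2` and
`x * s (n-2) = (s (n-2) * s (n-3) * ⋯ * s 1) * x ^ 2`. -/
theorem stmt17 (n : ℕ) (hn : 2 ≤ n) (s : ℕ → Equiv.Perm (Fin n))
    (hs : ∀ i (h1 : 1 ≤ i) (h2 : i ≤ n - 1),
      s i = Equiv.swap (⟨i - 1, by omega⟩ : Fin n) (⟨i, by omega⟩ : Fin n))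
    (x x' : Equiv.Perm (Fin n))
    (hx : x = ((List.range (n - 1)).map fun j => s (j + 1)).prod)
    (hx' : x' = ((List.range (n - 2)).map fun j => s (n - 2 - j)).prod)
    (A C : Subgroup (Equiv.Perm (Fin n)))
    (hA : A = MulAction.stabilizer (Equiv.Perm (Fin n)) (⟨n - 1, by omega⟩ : Fin n))
    (hC : C = Subgroup.zpowers x) :
    -- the factorization `S_n = S_{n-1} C_n`, `S_{n-1} ∩ C_n = 1`
    (∀ g : Equiv.Perm (Fin n), ∃ a ∈ A, ∃ c ∈ C, g = a * c) ∧
    A ⊓ C = ⊥ ∧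
    -- the identities in `S_n`
    (∀ i, 1 ≤ i → i < n - 2 → x * s i = s (i + 1) * x) ∧
    (3 ≤ n → x * s (n - 2) = x' * x ^ 2) ∧
    -- the values of the canonical matched pair
    (∀ (tr : C → A → A) (tl : C → A → C),
      (∀ (h : C) (a : A),
        (h : Equiv.Perm (Fin n)) * (a : Equiv.Perm (Fin n)) =
          (tr h a : Equiv.Perm (Fin n)) * (tl h a : Equiv.Perm (Fin n))) →
      (∀ i, 1 ≤ i → i < n - 2 →
        ∀ (hxC : x ∈ C) (hsA : s i ∈ A) (hsA' : s (i + 1) ∈ A),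
          tr ⟨x, hxC⟩ ⟨s i, hsA⟩ = ⟨s (i + 1), hsA'⟩ ∧
          tl ⟨x, hxC⟩ ⟨s i, hsA⟩ = ⟨x, hxC⟩) ∧
      (3 ≤ n →
        ∀ (hxC : x ∈ C) (hsA : s (n - 2) ∈ A) (hx'A : x' ∈ A) (hx2C : x ^ 2 ∈ C),
          tr ⟨x, hxC⟩ ⟨s (n - 2), hsA⟩ = ⟨x', hx'A⟩ ∧
          tl ⟨x, hxC⟩ ⟨s (n - 2), hsA⟩ = ⟨x ^ 2, hx2C⟩)) := by
  have hxv : ∀ i, (x i : ℕ) = (i + 1) % n := by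
    intro i
    rw [hx, val_prod_adjacent_swaps_apply s hs (n - 1) le_rfl]
    split_ifs with h1 h2
    · rw [Nat.mod_eq_of_lt (by omega)]
    · rw [h2, Nat.sub_add_cancel (by omega), Nat.mod_self]
    · omega
  have hd : Disjoint A C := by
    rw [hA, hC]
    exact stabilizer_disjoint_zpowers_of_val_apply hxv _
  have hcomm : ∀ i, 1 ≤ i → i < n - 2 → x * s i = s (i + 1) * x := by
    intro i h1 h2
    rw [hs i h1 (by omega), hs (i + 1) (by omega) (by omega), Equiv.mul_swap_eq_swap_mul]
    congr 2 <;> ext <;> rw [hxv] <;> dsimp only <;>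
      exact (Nat.mod_eq_of_lt (by omega)).trans (by omega)
  have hlast : 3 ≤ n → x * s (n - 2) = x' * x ^ 2 := by
    intro h3
    ext i
    have hval : ∀ j : Fin n, (x j : ℕ) = if (j : ℕ) = n - 1 then 0 else (j : ℕ) + 1 := by
      intro j
      rw [hxv]
      split_ifs with h
      · rw [h, Nat.sub_add_cancel (by omega), Nat.mod_self]
      · exact Nat.mod_eq_of_lt (by omega)
    rw [pow_two, Equiv.Perm.mul_apply, Equiv.Perm.mul_apply, Equiv.Perm.mul_apply, hx',
      val_prod_adjacent_swaps_descending_apply s hs (n - 2) (by omega) (n - 2) le_rfl,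
      hs (n - 2) (by omega) (by omega)]
    simp only [hval, val_swap_apply]
    split_ifs <;> omega
  refine ⟨?_, hd.eq_bot, hcomm, hlast, fun tr tl h => ⟨?_, ?_⟩⟩
  · rw [hA, hC]
    exact exists_stabilizer_mul_zpowers_of_val_apply hxv _
  · intro i h1 h2 hxC hsA hsA'
    exact Subgroup.eq_and_eq_of_mul_eq_of_disjoint hd ((h _ _).symm.trans (hcomm i h1 h2))
  · intro h3 hxC hsA hx'A hx2C
    exact Subgroup.eq_and_eq_of_mul_eq_of_disjoint hd ((h _ _).symm.trans (hlast h3))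
end

section
/- Let n be a positive integer and let (S_{n-1}, C_n, ▷, ◁) be the canonical matched pair associated to the factorization S_n = S_{n-1} C_n, where S_{n-1} ≤ S_n fixes n and C_n = ⟨x⟩ with x = s_1 s_2 ⋯ s_{n-1}. Then every group of order n is isomorphic to an r-deformation (C_n)_r of the cyclic group C_n, for some deformation map r : C_n → S_{n-1} of (S_{n-1}, C_n, ▷, ◁); the multiplication on (C_n)_r is given by x • y = (x ◁ r(y))y for x, y ∈ C_n. -/
/-- The partial products of `(0 1)(1 2)⋯` shift the points below the last one that is moved and
fix the points above it. -/
theorem prod_adjacent_swaps_apply {n : ℕ} (s : ℕ → Equiv.Perm (Fin n))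
    (hs : ∀ i (h1 : 1 ≤ i) (h2 : i ≤ n - 1),
      s i = Equiv.swap (⟨i - 1, by omega⟩ : Fin n) (⟨i, by omega⟩ : Fin n))
    (m : ℕ) (hm : m ≤ n - 1) (j : Fin n) :
    ((j : ℕ) < m → ((((List.range m).map fun i => s (i + 1)).prod j : Fin n) : ℕ) = j + 1) ∧
      (m < (j : ℕ) → ((List.range m).map fun i => s (i + 1)).prod j = j) := by
  induction m generalizing j with
  | zero => simp
  | succ m ih =>
    simp only [List.range_succ, List.map_append, List.map_cons, List.map_nil, List.prod_append,
      List.prod_cons, List.prod_nil, mul_one, Equiv.Perm.mul_apply]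
    have hsm := hs (m + 1) (by omega) hm
    simp only [Nat.add_sub_cancel] at hsm
    rw [hsm]
    refine ⟨fun hj => ?_, fun hj => ?_⟩
    · rcases Nat.lt_succ_iff_lt_or_eq.mp hj with hj | hj
      · rw [Equiv.swap_apply_of_ne_of_ne (by simp only [ne_eq, Fin.ext_iff]; omega)
          (by simp only [ne_eq, Fin.ext_iff]; omega)]
        exact (ih (by omega) j).1 hj
      · have hjm : j = ⟨m, by omega⟩ := Fin.ext hj
        rw [hjm, Equiv.swap_apply_left, (ih (by omega) _).2 (by simp)]
    · rw [Equiv.swap_apply_of_ne_of_ne (by simp only [ne_eq, Fin.ext_iff]; omega)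
        (by simp only [ne_eq, Fin.ext_iff]; omega)]
      exact (ih (by omega) j).2 (by omega)

/-- If the powers of a permutation `x` move `a` to every point, then inverses of elements of
`⟨x⟩` evaluated at any point `p` give a bijection from `⟨x⟩`. -/
theorem bijective_zpowers_inv_apply {α : Type*} (x : Equiv.Perm α) (a : α)
    (h : ∀ b, ∃ k : ℤ, (x ^ k) a = b) (p : α) :
    Function.Bijective fun c : Subgroup.zpowers x => (c : Equiv.Perm α)⁻¹ p := by
  have htrans : ∀ b c, ∃ k : ℤ, (x ^ k) b = c := by
    intro b c
    obtain ⟨i, rfl⟩ := h b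
    obtain ⟨j, rfl⟩ := h c
    exact ⟨j - i, by rw [← Equiv.Perm.mul_apply, ← zpow_add, sub_add_cancel]⟩
  constructor
  · rintro ⟨_, i, rfl⟩ ⟨_, j, rfl⟩ hij
    refine Subtype.ext (inv_injective (Equiv.ext fun b => ?_))
    obtain ⟨k, rfl⟩ := htrans p b
    simp only [← zpow_neg] at hij ⊢
    rw [← Equiv.Perm.mul_apply, ← Equiv.Perm.mul_apply, ← zpow_add, ← zpow_add, add_comm,
      add_comm (-j), zpow_add, zpow_add, Equiv.Perm.mul_apply, Equiv.Perm.mul_apply, hij]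
  · intro b
    obtain ⟨k, hk⟩ := htrans p b
    exact ⟨⟨x ^ (-k), -k, rfl⟩, by simpa using hk⟩

/-- Let `A` be the stabilizer of `p` and `C` a regular group of permutations, with matched pair
maps `tr`, `tl`. Every group acting regularly through `φ` is an `r`-deformation of `C`. -/
theorem exists_deformation_of_regular {α K : Type*} [Group K] (p : α)
    (A C : Subgroup (Equiv.Perm α)) (hA : A = MulAction.stabilizer (Equiv.Perm α) p)
    (hC : Function.Bijective fun c : C => (c : Equiv.Perm α)⁻¹ p)
    (tr : C → A → A) (tl : C → A → C)
    (hcanon : ∀ (h : C) (a : A), (h : Equiv.Perm α) * (a : Equiv.Perm α) =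
      (tr h a : Equiv.Perm α) * (tl h a : Equiv.Perm α))
    (φ : K →* Equiv.Perm α) (hφ : Function.Bijective fun k : K => (φ k)⁻¹ p) :
    ∃ r : C → A, r 1 = 1 ∧
      (∀ h g : C, r (tl h (r g) * g) = r h * tr h (r g)) ∧
      ∃ f : K → C, Function.Bijective f ∧
        ∀ a b : K, f (a * b) = tl (f a) (r (f b)) * f b := by
  let f : K ≃ C := (Equiv.ofBijective _ hφ).trans (Equiv.ofBijective _ hC).symm
  have hf : ∀ k, (f k : Equiv.Perm α)⁻¹ p = (φ k)⁻¹ p := fun k =>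
    (Equiv.ofBijective _ hC).apply_symm_apply ((φ k)⁻¹ p)
  have hmem : ∀ c : C, φ (f.symm c) * (c : Equiv.Perm α)⁻¹ ∈ A := by
    intro c
    have hc := hf (f.symm c)
    rw [f.apply_symm_apply] at hc
    rw [hA, MulAction.mem_stabilizer_iff, Equiv.Perm.smul_def, Equiv.Perm.mul_apply, hc]
    simp
  obtain ⟨r, hr⟩ : ∃ r : C → A, ∀ k, (r (f k) : Equiv.Perm α) * f k = φ k :=
    ⟨fun c => ⟨_, hmem c⟩, fun k => by simp⟩
  have huniq : ∀ (a : A) (c : C) (k : K), (a : Equiv.Perm α) * c = φ k → c = f k ∧ a = r c := by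
    intro a c k h
    have ha : (a : Equiv.Perm α)⁻¹ p = p := by
      have hmem_inv : (a : Equiv.Perm α)⁻¹ ∈ MulAction.stabilizer (Equiv.Perm α) p :=
        hA.le (inv_mem a.2)
      exact hmem_inv
    have hc : c = f k := hC.1 <| by
      change (c : Equiv.Perm α)⁻¹ p = (f k : Equiv.Perm α)⁻¹ p
      rw [hf, ← h, mul_inv_rev, Equiv.Perm.mul_apply, ha]
    refine ⟨hc, Subtype.ext (mul_right_cancel (b := (c : Equiv.Perm α)) ?_)⟩
    rw [h, hc, hr]
  have hmul : ∀ a b : K, ((r (f a) * tr (f a) (r (f b)) : A) : Equiv.Perm α) *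
      (tl (f a) (r (f b)) * f b : C) = φ (a * b) := by
    intro a b
    rw [map_mul, ← hr a, ← hr b, Subgroup.coe_mul, Subgroup.coe_mul]
    simp only [mul_assoc]
    rw [← mul_assoc (f a : Equiv.Perm α), hcanon, mul_assoc]
  refine ⟨r, (huniq 1 1 1 (by simp)).2.symm, fun h g => ?_, f, f.bijective, fun a b =>
    (huniq _ _ _ (hmul a b)).1.symm⟩
  have := (huniq _ _ _ (hmul (f.symm h) (f.symm g))).2.symm
  simpa only [f.apply_symm_apply] using this


/-- Let `S_n = Perm (Fin n)` (0-indexed) with `s i` (for `1 ≤ i ≤ n-1`) the adjacent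
transposition `(i, i+1)` (1-indexed), `A = S_{n-1}` the stabilizer of the last point,
`x = s 1 * s 2 * ⋯ * s (n-1)` and `C = C_n = ⟨x⟩`, and let `(S_{n-1}, C_n, ▷, ◁)` be the
canonical matched pair of the factorization `S_n = S_{n-1} C_n` (determined by
`h a = (h ▷ a)(h ◁ a)`).  Then every group `K` of order `n` is isomorphic to the
`r`-deformation `(C_n)_r` — the set `C_n` with multiplication `x • y = (x ◁ r(y)) y` —
for some deformation map `r : C_n → S_{n-1}`. -/
theorem stmt18 (n : ℕ) (hn : 0 < n) (s : ℕ → Equiv.Perm (Fin n))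
    (hs : ∀ i (h1 : 1 ≤ i) (h2 : i ≤ n - 1),
      s i = Equiv.swap (⟨i - 1, by omega⟩ : Fin n) (⟨i, by omega⟩ : Fin n))
    (x : Equiv.Perm (Fin n))
    (hx : x = ((List.range (n - 1)).map fun j => s (j + 1)).prod)
    (A C : Subgroup (Equiv.Perm (Fin n)))
    (hA : A = MulAction.stabilizer (Equiv.Perm (Fin n)) (⟨n - 1, by omega⟩ : Fin n))
    (hC : C = Subgroup.zpowers x)
    (tr : C → A → A) (tl : C → A → C)
    (hcanon : ∀ (h : C) (a : A),
      (h : Equiv.Perm (Fin n)) * (a : Equiv.Perm (Fin n)) =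
        (tr h a : Equiv.Perm (Fin n)) * (tl h a : Equiv.Perm (Fin n)))
    (K : Type*) [Group K] [Fintype K] (hK : Fintype.card K = n) :
    ∃ r : C → A, r 1 = 1 ∧
      (∀ h g : C, r (tl h (r g) * g) = r h * tr h (r g)) ∧
      ∃ f : K → C, Function.Bijective f ∧
        ∀ a b : K, f (a * b) = tl (f a) (r (f b)) * f b := by
  have hstep : ∀ j : Fin n, (j : ℕ) < n - 1 → ((x j : Fin n) : ℕ) = j + 1 := fun j =>
    hx ▸ (prod_adjacent_swaps_apply s hs (n - 1) le_rfl j).1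
  have horbit : ∀ m (hm : m < n), (x ^ m) ⟨0, hn⟩ = ⟨m, hm⟩ := by
    intro m
    induction m with
    | zero => intro _; rfl
    | succ m ih =>
      intro hm
      rw [pow_succ', Equiv.Perm.mul_apply, ih (by omega)]
      exact Fin.ext (hstep _ (by simp only; omega))
  subst hC
  have e : K ≃ Fin n := Fintype.equivFinOfCardEq hK
  refine exists_deformation_of_regular _ A _ hA
    (bijective_zpowers_inv_apply x ⟨0, hn⟩ (fun b => ⟨(b : ℕ), by simp [horbit b b.2]⟩) _)
    tr tl hcanon (e.permCongrHom.toMonoidHom.comp (MulAction.toPermHom K K)) ?_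
  have hval : (fun k : K => ((e.permCongrHom.toMonoidHom.comp (MulAction.toPermHom K K)) k)⁻¹
      (⟨n - 1, by omega⟩ : Fin n)) = fun k => e (k⁻¹ * e.symm ⟨n - 1, by omega⟩) := by
    funext k
    rw [← map_inv]
    rfl
  rw [hval]
  exact e.bijective.comp ((Group.mulRight_bijective _).comp (Equiv.inv K).bijective)
end
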